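/- Let G : ℝ × ℝ^N → ℝ^{N×N} be Borel measurable, let j ∈ ℕ, and suppose there is a locally integrable m^j : ℝ → [0,∞) with ‖G(t,x)‖ ≤ m^j(t) (operator norm) for a.e. t ∈ ℝ and all x ∈ ℝ^N with |x| ≤ j, such that α := sup_{s ∈ ℝ} ∫_s^{s+1} m^j(u) du < ∞. Let x : ℝ → ℝ^N be continuous with |x(t)| ≤ j for all t ∈ ℝ. Then there exist constants K ≥ 1 and γ ≥ 0 such that every continuous y : ℝ → ℝ^N satisfying y(t) = y(s) + ∫_s^t G(u, x(u)) y(u) du for all s, t ∈ ℝ obeys |y(t)| ≤ K e^{γ|t−s|} |y(s)| for all s, t ∈ ℝ; that is, the linear system ẏ = G(t, x(t)) y has bounded growth. -/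

import Mathlib

open MeasureTheory Set Filter Topology
open scoped RealInnerProductSpace

noncomputable section

abbrev Euc (n : ℕ) := EuclideanSpace ℝ (Fin n)

/-- A function `ℝ → ℝ` is locally integrable (w.r.t. Lebesgue measure) on every
compact interval. -/
def LocInt (m : ℝ → ℝ) : Prop := ∀ a b : ℝ, IntegrableOn m (Icc a b)

section Defs

variable {N : ℕ} {F : Type*} [NormedAddCommGroup F] [NormedSpace ℝ F]

/-- The Carathéodory conditions (C1) and (C2). -/
def IsCara (f : ℝ → Euc N → F) : Prop :=
  StronglyMeasurable (Function.uncurry f) ∧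
  ∀ K : Set (Euc N), IsCompact K → ∃ m : ℝ → ℝ, (∀ t, 0 ≤ m t) ∧ LocInt m ∧
    ∀ᵐ t : ℝ, ∀ x ∈ K, ‖f t x‖ ≤ m t

/-- A suitable set of moduli of continuity `Θ = {θ_j^{[q₁,q₂]}}`. -/
structure SuitableModuli where
  θ : ℕ → ℚ → ℚ → ℝ → ℝ
  nonneg : ∀ j q₁ q₂ s, (0:ℝ) ≤ s → 0 ≤ θ j q₁ q₂ s
  cont : ∀ j q₁ q₂, ContinuousOn (θ j q₁ q₂) (Ici 0)
  mono : ∀ j q₁ q₂, MonotoneOn (θ j q₁ q₂) (Ici 0)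
  zero : ∀ j q₁ q₂, θ j q₁ q₂ 0 = 0
  ordered : ∀ j₁ j₂ q₁ q₂ p₁ p₂, j₁ ≤ j₂ → p₁ ≤ q₁ → q₂ ≤ p₂ →
    ∀ s : ℝ, 0 ≤ s → θ j₁ q₁ q₂ s ≤ θ j₂ p₁ p₂ s

/-- `x ∈ K_j^{[q₁,q₂]}`: continuous, bounded by `j` and with modulus of continuity
`θ_j^{[q₁,q₂]}` on `[q₁,q₂]`. -/
def inK {N : ℕ} (Θ : SuitableModuli) (j : ℕ) (q₁ q₂ : ℚ) (x : ℝ → Euc N) : Prop :=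
  ContinuousOn x (Icc (q₁:ℝ) (q₂:ℝ)) ∧
  (∀ t ∈ Icc (q₁:ℝ) (q₂:ℝ), ‖x t‖ ≤ (j:ℝ)) ∧
  ∀ t ∈ Icc (q₁:ℝ) (q₂:ℝ), ∀ s ∈ Icc (q₁:ℝ) (q₂:ℝ), ‖x t - x s‖ ≤ Θ.θ j q₁ q₂ |t - s|

/-- Weak Θ-Carathéodory functions: Carathéodory conditions plus condition (W). -/
def IsWTC (Θ : SuitableModuli) (f : ℝ → Euc N → F) : Prop :=
  IsCara f ∧
  ∀ (j : ℕ) (q₁ q₂ : ℚ) (xs : ℕ → ℝ → Euc N) (x : ℝ → Euc N),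
    (∀ n, inK Θ j q₁ q₂ (xs n)) → inK Θ j q₁ q₂ x →
    TendstoUniformlyOn (fun n t => xs n t) x atTop (Icc (q₁:ℝ) (q₂:ℝ)) →
    Tendsto (fun n => ∫ t in Icc (q₁:ℝ) (q₂:ℝ), f t (xs n t)) atTop
      (𝓝 (∫ t in Icc (q₁:ℝ) (q₂:ℝ), f t (x t)))

/-- Convergence in the `σ_Θ` sense:
`sup_{x ∈ K_j^I} ‖∫_I (f_n(t,x(t)) − f(t,x(t))) dt‖ → 0` for every `j` and `I`. -/
def SigmaTendsto (Θ : SuitableModuli) (fs : ℕ → ℝ → Euc N → F) (f : ℝ → Euc N → F) : Prop :=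
  ∀ (j : ℕ) (q₁ q₂ : ℚ), ∀ ε > (0:ℝ), ∀ᶠ n in atTop, ∀ x : ℝ → Euc N, inK Θ j q₁ q₂ x →
    ‖∫ t in Icc (q₁:ℝ) (q₂:ℝ), (fs n t (x t) - f t (x t))‖ < ε

end Defs

/-- Lipschitz Carathéodory functions. -/
def IsLC {N : ℕ} (f : ℝ → Euc N → Euc N) : Prop :=
  IsCara f ∧
  ∀ K : Set (Euc N), IsCompact K → ∃ l : ℝ → ℝ, LocInt l ∧
    ∀ᵐ t : ℝ, ∀ x ∈ K, ∀ y ∈ K, ‖f t x - f t y‖ ≤ l t * ‖x - y‖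

/-- The optimal m-bound of `f` on the closed ball `B_j`. -/
def mOpt {N : ℕ} (f : ℝ → Euc N → Euc N) (j : ℕ) (t : ℝ) : ℝ :=
  sSup {v : ℝ | ∃ x : Euc N, ‖x‖ ≤ (j:ℝ) ∧ v = ‖f t x‖}

/-- The time translation `f_r(s,x) = f(s+r,x)`. -/
def timeTranslate {N : ℕ} (f : ℝ → Euc N → Euc N) (r : ℝ) : ℝ → Euc N → Euc N :=
  fun s x => f (s + r) x

/-- `x` is a solution of `ẋ = g(t,x)`, `x(0) = x₀`, defined on `[0,∞)`. -/
def IsSolOn {N : ℕ} (g : ℝ → Euc N → Euc N) (x₀ : Euc N) (x : ℝ → Euc N) : Prop :=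
  ContinuousOn x (Ici 0) ∧ ∀ t ∈ Ici (0:ℝ), x t = x₀ + ∫ s in (0:ℝ)..t, g s (x s)

theorem LocInt.intervalIntegrable {m : ℝ → ℝ} (hm : LocInt m) (a b : ℝ) :
    IntervalIntegrable m volume a b :=
  intervalIntegrable_iff.2 ((hm (min a b) (max a b)).mono_set Ioc_subset_Icc_self)

/-- A bound on unit intervals gives linear growth of the integral. -/
theorem LocInt.integral_le_mul {m : ℝ → ℝ} (hm : LocInt m) (hm0 : ∀ t, 0 ≤ m t) {α : ℝ}
    (hα : ∀ s : ℝ, ∫ u in Icc s (s + 1), m u ≤ α) {a b : ℝ} (hab : a ≤ b) :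
    ∫ u in a..b, m u ≤ α * (b - a + 1) := by
  have hα0 : 0 ≤ α := (integral_nonneg hm0).trans (hα 0)
  have key : ∀ n : ℕ, ∫ u in a..(a + n), m u ≤ n * α := by
    intro n
    induction n with
    | zero => simp
    | succ n ih =>
      rw [← intervalIntegral.integral_add_adjacent_intervals
        (hm.intervalIntegrable a (a + n)) (hm.intervalIntegrable _ _)]
      have h := hα (a + n)
      rw [integral_Icc_eq_integral_Ioc, ← intervalIntegral.integral_of_le (by linarith)] at h
      push_cast
      rw [← add_assoc]
      linarith
  have hceil := Nat.le_ceil (b - a)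
  have hceil' := Nat.ceil_lt_add_one (sub_nonneg.2 hab)
  calc ∫ u in a..b, m u ≤ ∫ u in a..(a + ⌈b - a⌉₊), m u :=
        intervalIntegral.integral_mono_interval le_rfl hab (by linarith)
          (Eventually.of_forall hm0) (hm.intervalIntegrable _ _)
    _ ≤ ⌈b - a⌉₊ * α := key _
    _ ≤ α * (b - a + 1) := by nlinarith

section IntegralEquation

variable {E : Type*} [NormedAddCommGroup E] [NormedSpace ℝ E] {m : ℝ → ℝ} {y g : ℝ → E}

/-- On an interval where `m` has integral at most `1 / 2`, the norms of a solution at any two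
points are comparable up to a factor `2`. -/
theorem norm_le_two_mul_of_integral_le_half (hm : LocInt m) (hm0 : ∀ t, 0 ≤ m t)
    (hy : Continuous y) (hg : ∀ᵐ u : ℝ, ‖g u‖ ≤ m u * ‖y u‖)
    (hsol : ∀ s t : ℝ, y t = y s + ∫ u in s..t, g u) {a b : ℝ} (hab : a ≤ b)
    (hint : ∫ u in a..b, m u ≤ 1 / 2) {p q : ℝ} (hp : p ∈ Icc a b) (hq : q ∈ Icc a b) :
    ‖y p‖ ≤ 2 * ‖y q‖ := by
  obtain ⟨c, hc, hmax⟩ := isCompact_Icc.exists_isMaxOn ⟨a, left_mem_Icc.2 hab⟩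
    hy.norm.continuousOn
  have hsub : uIoc q c ⊆ Ioc a b := by
    rw [uIoc]
    exact Ioc_subset_Ioc (le_min hq.1 hc.1) (max_le hq.2 hc.2)
  have h1 : ‖∫ u in q..c, g u‖ ≤ ∫ u in uIoc q c, m u * ‖y c‖ := by
    refine (intervalIntegral.norm_intervalIntegral_eq _ _ _ _).trans_le ?_
    refine norm_integral_le_of_norm_le ?_ ?_
    · exact (intervalIntegrable_iff.1 (hm.intervalIntegrable q c)).mul_const _
    · filter_upwards [ae_restrict_of_ae hg, ae_restrict_mem measurableSet_uIoc] with u hu hmem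
      exact hu.trans (mul_le_mul_of_nonneg_left
        (hmax (Ioc_subset_Icc_self (hsub hmem))) (hm0 u))
  have h2 : ∫ u in uIoc q c, m u ≤ 1 / 2 := by
    rw [intervalIntegral.integral_of_le hab] at hint
    exact (setIntegral_mono_set ((hm a b).mono_set Ioc_subset_Icc_self)
      (Eventually.of_forall hm0) hsub.eventuallyLE).trans hint
  rw [integral_mul_const] at h1
  have h3 : ‖y c‖ ≤ ‖y q‖ + ‖∫ u in q..c, g u‖ := by
    rw [hsol q c]
    exact norm_add_le _ _
  have h4 : ‖y p‖ ≤ ‖y c‖ := hmax hp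
  nlinarith [mul_le_mul_of_nonneg_right h2 (norm_nonneg (y c))]

theorem norm_le_two_pow_mul_of_integral_le (hm : LocInt m) (hm0 : ∀ t, 0 ≤ m t)
    (hy : Continuous y) (hg : ∀ᵐ u : ℝ, ‖g u‖ ≤ m u * ‖y u‖)
    (hsol : ∀ s t : ℝ, y t = y s + ∫ u in s..t, g u) (n : ℕ) {a b : ℝ} (hab : a ≤ b)
    (hint : ∫ u in a..b, m u ≤ (n + 1) / 2) :
    ‖y b‖ ≤ 2 ^ (n + 1) * ‖y a‖ ∧ ‖y a‖ ≤ 2 ^ (n + 1) * ‖y b‖ := by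
  induction n generalizing b with
  | zero =>
    have h : ∫ u in a..b, m u ≤ 1 / 2 := by simpa using hint
    have ha : a ∈ Icc a b := left_mem_Icc.2 hab
    have hb : b ∈ Icc a b := right_mem_Icc.2 hab
    simpa using And.intro (norm_le_two_mul_of_integral_le_half hm hm0 hy hg hsol hab h hb ha)
      (norm_le_two_mul_of_integral_le_half hm hm0 hy hg hsol hab h ha hb)
  | succ n ih =>
    obtain ⟨c, hc, hac, hcb⟩ : ∃ c ∈ Icc a b,
        ∫ u in a..c, m u ≤ (n + 1) / 2 ∧ ∫ u in c..b, m u ≤ 1 / 2 := by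
      rcases le_total (∫ u in a..b, m u) ((n + 1) / 2) with h | h
      · exact ⟨b, right_mem_Icc.2 hab, h, by simp⟩
      · have hcont : ContinuousOn (fun t => ∫ u in a..t, m u) (Icc a b) :=
          (intervalIntegral.continuous_primitive hm.intervalIntegrable a).continuousOn
        obtain ⟨c, hc, hce⟩ := intermediate_value_Icc hab hcont
          (show ((n : ℝ) + 1) / 2 ∈ _ from ⟨by simp; positivity, h⟩)
        refine ⟨c, hc, hce.le, ?_⟩
        have := intervalIntegral.integral_add_adjacent_intervals
          (hm.intervalIntegrable a c) (hm.intervalIntegrable c b)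
        push_cast at hint
        simp only at hce
        linarith
    obtain ⟨h1, h2⟩ := ih hc.1 hac
    have hcm : c ∈ Icc c b := left_mem_Icc.2 hc.2
    have hbm : b ∈ Icc c b := right_mem_Icc.2 hc.2
    have h3 := norm_le_two_mul_of_integral_le_half hm hm0 hy hg hsol hc.2 hcb hbm hcm
    have h4 := norm_le_two_mul_of_integral_le_half hm hm0 hy hg hsol hc.2 hcb hcm hbm
    constructor
    · calc ‖y b‖ ≤ 2 * ‖y c‖ := h3
        _ ≤ 2 * (2 ^ (n + 1) * ‖y a‖) := by gcongr
        _ = 2 ^ (n + 1 + 1) * ‖y a‖ := by ring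
    · calc ‖y a‖ ≤ 2 ^ (n + 1) * ‖y c‖ := h2
        _ ≤ 2 ^ (n + 1) * (2 * ‖y b‖) := by gcongr
        _ = 2 ^ (n + 1 + 1) * ‖y b‖ := by ring

end IntegralEquation

/-- bounded growth for the linear system `ẏ = G(t,x(t))y` when the
m-bound of `G` on `B_j` has uniformly bounded integrals over unit intervals and
`x` takes values in `B_j`. -/
theorem stmt10 {N : ℕ} (G : ℝ → Euc N → (Euc N →L[ℝ] Euc N))
    (hG : StronglyMeasurable (Function.uncurry G))
    (j : ℕ) (mj : ℝ → ℝ) (hmj_nonneg : ∀ t, 0 ≤ mj t) (hmj_int : LocInt mj)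
    (hbound : ∀ᵐ t : ℝ, ∀ x : Euc N, ‖x‖ ≤ (j:ℝ) → ‖G t x‖ ≤ mj t)
    (α : ℝ) (hα : ∀ s : ℝ, ∫ u in Icc s (s + 1), mj u ≤ α)
    (x : ℝ → Euc N) (hx : Continuous x) (hxb : ∀ t, ‖x t‖ ≤ (j:ℝ)) :
    ∃ K ≥ (1:ℝ), ∃ γ ≥ (0:ℝ), ∀ y : ℝ → Euc N, Continuous y →
      (∀ s t : ℝ, y t = y s + ∫ u in s..t, (G u (x u)) (y u)) →
      ∀ s t : ℝ, ‖y t‖ ≤ K * Real.exp (γ * |t - s|) * ‖y s‖ := by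
  have hα0 : 0 ≤ α := (integral_nonneg hmj_nonneg).trans (hα 0)
  refine ⟨Real.exp (2 * α + 1), Real.one_le_exp (by positivity), 2 * α, by positivity, ?_⟩
  intro y hy hsol
  have hg : ∀ᵐ u : ℝ, ‖(G u (x u)) (y u)‖ ≤ mj u * ‖y u‖ := by
    filter_upwards [hbound] with u hu
    exact (G u (x u)).le_of_opNorm_le (hu _ (hxb u)) _
  have key : ∀ a b : ℝ, a ≤ b →
      ‖y b‖ ≤ Real.exp (2 * α + 1) * Real.exp (2 * α * (b - a)) * ‖y a‖ ∧
      ‖y a‖ ≤ Real.exp (2 * α + 1) * Real.exp (2 * α * (b - a)) * ‖y b‖ := by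
    intro a b hab
    have hX : 0 ≤ 2 * (α * (b - a + 1)) :=
      mul_nonneg two_pos.le (mul_nonneg hα0 (by linarith))
    set n := ⌊2 * (α * (b - a + 1))⌋₊
    have hint : ∫ u in a..b, mj u ≤ ((n : ℝ) + 1) / 2 := by
      have h1 := hmj_int.integral_le_mul hmj_nonneg hα hab
      have h2 : 2 * (α * (b - a + 1)) < (n : ℝ) + 1 := Nat.lt_floor_add_one _
      linarith
    have hpow : (2 : ℝ) ^ (n + 1) ≤ Real.exp (2 * α + 1) * Real.exp (2 * α * (b - a)) := by
      have h2 : (2 : ℝ) ≤ Real.exp 1 := by linarith [Real.add_one_le_exp (1 : ℝ)]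
      have hn : (n : ℝ) ≤ 2 * (α * (b - a + 1)) := Nat.floor_le hX
      calc (2 : ℝ) ^ (n + 1) ≤ Real.exp 1 ^ (n + 1) := by gcongr
        _ = Real.exp ((n : ℝ) + 1) := by
          rw [← Real.exp_nat_mul]
          push_cast
          rw [mul_one]
        _ ≤ Real.exp (2 * α + 1 + 2 * α * (b - a)) := Real.exp_le_exp.2 (by linarith)
        _ = _ := Real.exp_add _ _
    obtain ⟨h1, h2⟩ :=
      norm_le_two_pow_mul_of_integral_le hmj_int hmj_nonneg hy hg hsol n hab hint
    exact ⟨h1.trans (by gcongr), h2.trans (by gcongr)⟩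
  intro s t
  rcases le_total s t with h | h
  · rw [abs_of_nonneg (sub_nonneg.2 h)]
    exact (key s t h).1
  · rw [abs_sub_comm, abs_of_nonneg (sub_nonneg.2 h)]
    exact (key t s h).2
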